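/- For all x in [0,1], all positive integers n, and 0<q<1, the q-Durrmeyer operator satisfies D_{n,q}(t;x) = (1 + q x [n]_q)/[n+2]_q. -/

import Mathlib

open Finset Filter Topology

/-- The q-integer `[n]_q = 1 + q + ⋯ + q^(n-1)`. -/
noncomputable def qInt (q : ℝ) (n : ℕ) : ℝ := ∑ i ∈ Finset.range n, q ^ i

/-- The q-factorial `[n]_q!`. -/
noncomputable def qFact (q : ℝ) (n : ℕ) : ℝ := ∏ i ∈ Finset.range n, qInt q (i + 1)

/-- The q-binomial coefficient. -/
noncomputable def qBinom (q : ℝ) (n k : ℕ) : ℝ := qFact q n / (qFact q k * qFact q (n - k))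

/-- `(1 - x)_q^n = ∏_{j=0}^{n-1} (1 - q^j x)`. -/
noncomputable def qOneSubPow (q x : ℝ) (n : ℕ) : ℝ := ∏ j ∈ Finset.range n, (1 - q ^ j * x)

/-- The q-Bernstein basis `p_{nk}(q;x)`. -/
noncomputable def qBern (q : ℝ) (n k : ℕ) (x : ℝ) : ℝ :=
  qBinom q n k * x ^ k * qOneSubPow q x (n - k)

/-- The Jackson q-integral on `[0,1]`. -/
noncomputable def qIntegral (q : ℝ) (g : ℝ → ℝ) : ℝ := (1 - q) * ∑' j : ℕ, q ^ j * g (q ^ j)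

/-- The q-Durrmeyer operator `D_{n,q}(f;x)`. -/
noncomputable def qDurrmeyer (q : ℝ) (n : ℕ) (f : ℝ → ℝ) (x : ℝ) : ℝ :=
  qInt q (n + 1) * ∑ k ∈ Finset.range (n + 1),
    q ^ (-(k : ℤ)) * qBern q n k x * qIntegral q (fun t => f t * qBern q n k (q * t))

/-- The q-Durrmeyer–Stancu operator `D_{n,q}^{α,β}(f;x)`. -/
noncomputable def qDurrmeyerStancu (q : ℝ) (n : ℕ) (α β : ℝ) (f : ℝ → ℝ) (x : ℝ) : ℝ :=
  qDurrmeyer q n (fun t => f ((qInt q n * t + α) / (qInt q n + β))) x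

/-- The q-derivative `D_q f(x) = (f(qx) - f(x)) / ((q-1)x)`. -/
noncomputable def qDeriv (q : ℝ) (f : ℝ → ℝ) (x : ℝ) : ℝ := (f (q * x) - f x) / ((q - 1) * x)

/-- The q-power `(t - x)_q^m = ∏_{j=0}^{m-1} (t - q^j x)`, as a function of `t`. -/
noncomputable def qCentral (q x : ℝ) (m : ℕ) (t : ℝ) : ℝ := ∏ j ∈ Finset.range m, (t - q ^ j * x)

lemma qInt_succ (q : ℝ) (n : ℕ) : qInt q (n + 1) = qInt q n + q ^ n :=
  Finset.sum_range_succ _ _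

lemma qInt_succ' (q : ℝ) (n : ℕ) : qInt q (n + 1) = 1 + q * qInt q n := by
  simp only [qInt, Finset.sum_range_succ', Finset.mul_sum, pow_succ']
  ring

lemma qInt_add (q : ℝ) (a b : ℕ) : qInt q (a + b) = qInt q a + q ^ a * qInt q b := by
  simp only [qInt, Finset.sum_range_add, Finset.mul_sum, pow_add]

lemma qInt_succ_pos {q : ℝ} (hq : 0 < q) (n : ℕ) : 0 < qInt q (n + 1) :=
  Finset.sum_pos (fun _ _ => pow_pos hq _) (by simp)

lemma qInt_mul_one_sub (q : ℝ) (n : ℕ) : qInt q n * (1 - q) = 1 - q ^ n :=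
  geom_sum_mul_neg q n

lemma qFact_zero (q : ℝ) : qFact q 0 = 1 :=
  Finset.prod_range_zero _

lemma qFact_succ (q : ℝ) (n : ℕ) : qFact q (n + 1) = qFact q n * qInt q (n + 1) :=
  Finset.prod_range_succ _ _

lemma qFact_pos {q : ℝ} (hq : 0 < q) (n : ℕ) : 0 < qFact q n :=
  Finset.prod_pos fun i _ => qInt_succ_pos hq i

lemma qOneSubPow_succ (q x : ℝ) (n : ℕ) :
    qOneSubPow q x (n + 1) = qOneSubPow q x n * (1 - q ^ n * x) :=
  Finset.prod_range_succ _ _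

/-- The q-Beta integral `∫₀¹ t^k (1 - qt)_q^m d_q t = [k]_q! [m]_q! / [k+m+1]_q!`. -/
lemma hasSum_qBeta {q : ℝ} (hq0 : 0 < q) (hq1 : q < 1) (k m : ℕ) :
    HasSum (fun j : ℕ => (1 - q) * (q ^ j * ((q ^ j) ^ k * qOneSubPow q (q * q ^ j) m)))
      (qFact q k * qFact q m / qFact q (k + m + 1)) := by
  induction m generalizing k with
  | zero =>
    have hlt : q ^ (k + 1) < 1 := pow_lt_one₀ hq0.le hq1 k.succ_ne_zero
    have h := (hasSum_geometric_of_lt_one (by positivity) hlt).mul_left (1 - q)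
    convert h using 1
    · rfl
    · funext j
      simp only [qOneSubPow, Finset.prod_range_zero]
      ring
    · have := qInt_mul_one_sub q (k + 1)
      have := qFact_pos hq0 k
      have := qInt_succ_pos hq0 k
      have : 1 - q ^ (k + 1) ≠ 0 := by linarith
      rw [add_zero, qFact_zero, qFact_succ]
      field_simp
      linarith
  | succ m ih =>
    convert (ih k).sub ((ih (k + 1)).mul_left (q ^ (m + 1))) using 1
    · rfl
    · funext j
      rw [qOneSubPow_succ]
      ring
    · have := qFact_pos hq0 (k + m + 1)
      have := qInt_succ_pos hq0 (k + m + 1)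
      have h : qInt q (k + m + 1 + 1) = qInt q (m + 1) + q ^ (m + 1) * qInt q (k + 1) := by
        rw [← qInt_add]
        congr 1
        ring
      rw [show k + (m + 1) + 1 = k + m + 1 + 1 by ring, show k + 1 + m + 1 = k + m + 1 + 1 by ring,
        qFact_succ q (k + m + 1), qFact_succ q k, qFact_succ q m]
      field_simp
      rw [h]
      ring

lemma qIntegral_id_mul_qBern {q : ℝ} (hq0 : 0 < q) (hq1 : q < 1) {n k : ℕ} (hk : k ≤ n) :
    qIntegral q (fun t => t * qBern q n k (q * t)) =
      q ^ k * (qInt q (k + 1) / (qInt q (n + 1) * qInt q (n + 2))) := by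
  have h := ((hasSum_qBeta hq0 hq1 (k + 1) (n - k)).mul_left (q ^ k * qBinom q n k)).tsum_eq
  rw [qIntegral, ← tsum_mul_left]
  convert h using 1
  · congr 1
    funext j
    simp only [qBern]
    ring
  · have := qFact_pos hq0 n
    have := qFact_pos hq0 k
    have := qFact_pos hq0 (n - k)
    have := qInt_succ_pos hq0 n
    have := qInt_succ_pos hq0 (n + 1)
    rw [show k + 1 + (n - k) + 1 = n + 1 + 1 by omega, qFact_succ q (n + 1), qFact_succ q n,
      qFact_succ q k, qBinom]
    field_simp

lemma qBern_succ_zero {q : ℝ} (hq : 0 < q) (n : ℕ) (x : ℝ) :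
    qBern q (n + 1) 0 x = (1 - q ^ n * x) * qBern q n 0 x := by
  have := qFact_pos hq n
  have := qFact_pos hq (n + 1)
  simp only [qBern, qBinom, Nat.sub_zero, qOneSubPow_succ, qFact_zero]
  field_simp

lemma qBern_succ_self {q : ℝ} (hq : 0 < q) (n : ℕ) (x : ℝ) :
    qBern q (n + 1) (n + 1) x = x * qBern q n n x := by
  have := qFact_pos hq n
  have := qFact_pos hq (n + 1)
  simp only [qBern, qBinom, Nat.sub_self, qFact_zero]
  field_simp
  ring

lemma qBern_succ_succ {q : ℝ} (hq : 0 < q) {n k : ℕ} (hk : k < n) (x : ℝ) :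
    qBern q (n + 1) (k + 1) x =
      q ^ (n - k) * x * qBern q n k x + (1 - q ^ (n - (k + 1)) * x) * qBern q n (k + 1) x := by
  obtain ⟨m, rfl⟩ := Nat.exists_eq_add_of_lt hk
  have := qFact_pos hq k
  have := qFact_pos hq m
  have := qInt_succ_pos hq k
  have := qInt_succ_pos hq m
  have h : qInt q (k + m + 1 + 1) = qInt q (m + 1) + q ^ (m + 1) * qInt q (k + 1) := by
    rw [← qInt_add]
    congr 1
    ring
  simp only [qBern, qBinom, show k + m + 1 + 1 - (k + 1) = m + 1 by omega,
    show k + m + 1 - k = m + 1 by omega, show k + m + 1 - (k + 1) = m by omega,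
    qOneSubPow_succ, qFact_succ q (k + m + 1), qFact_succ q k, qFact_succ q m, h]
  field_simp
  ring

lemma sum_qBern {q : ℝ} (hq : 0 < q) (n : ℕ) (x : ℝ) :
    ∑ k ∈ Finset.range (n + 1), qBern q n k x = 1 := by
  induction n with
  | zero => simp [qBern, qBinom, qFact_zero, qOneSubPow]
  | succ n ih =>
    set g : ℕ → ℝ := fun k => q ^ (n - k) * x * qBern q n k x with hg
    have hmid : ∑ k ∈ Finset.range n, qBern q (n + 1) (k + 1) x =
        (g 0 - g n) + ∑ k ∈ Finset.range n, qBern q n (k + 1) x := by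
      rw [← Finset.sum_range_sub', ← Finset.sum_add_distrib]
      refine Finset.sum_congr rfl fun k hk => ?_
      rw [qBern_succ_succ hq (Finset.mem_range.mp hk)]
      ring
    rw [Finset.sum_range_succ'] at ih
    rw [Finset.sum_range_succ', Finset.sum_range_succ, hmid, qBern_succ_zero hq,
      qBern_succ_self hq]
    simp only [hg, Nat.sub_self, Nat.sub_zero]
    linear_combination ih

lemma qInt_mul_qBern_succ {q : ℝ} (hq : 0 < q) (n k : ℕ) (x : ℝ) :
    qInt q (k + 1) * qBern q (n + 1) (k + 1) x = qInt q (n + 1) * x * qBern q n k x := by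
  have := qFact_pos hq k
  have := qFact_pos hq (n - k)
  have := qInt_succ_pos hq k
  simp only [qBern, qBinom, Nat.add_sub_add_right, qFact_succ]
  field_simp
  ring

lemma sum_qInt_mul_qBern {q : ℝ} (hq : 0 < q) (n : ℕ) (x : ℝ) :
    ∑ k ∈ Finset.range (n + 1), qInt q k * qBern q n k x = qInt q n * x := by
  cases n with
  | zero => simp [qInt]
  | succ n =>
    rw [Finset.sum_range_succ']
    simp only [qInt_mul_qBern_succ hq]
    rw [← Finset.mul_sum, sum_qBern hq]
    simp [qInt]

/-- First moment of the q-Durrmeyer operator. -/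
theorem qDurrmeyer_first_moment (q x : ℝ) (hq0 : 0 < q) (hq1 : q < 1)
    (n : ℕ) (hn : 0 < n) (hx : x ∈ Set.Icc (0 : ℝ) 1) :
    qDurrmeyer q n (fun t => t) x = (1 + q * x * qInt q n) / qInt q (n + 2) := by
  have hterm : ∀ k ∈ Finset.range (n + 1),
      q ^ (-(k : ℤ)) * qBern q n k x * qIntegral q (fun t => t * qBern q n k (q * t)) =
        (qBern q n k x + q * (qInt q k * qBern q n k x)) / (qInt q (n + 1) * qInt q (n + 2)) := by
    intro k hk
    rw [qIntegral_id_mul_qBern hq0 hq1 (Nat.lt_succ_iff.mp (Finset.mem_range.mp hk)),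
      zpow_neg, zpow_natCast, qInt_succ' q k]
    field_simp
  have := qInt_succ_pos hq0 n
  have := qInt_succ_pos hq0 (n + 1)
  rw [qDurrmeyer, Finset.sum_congr rfl hterm, ← Finset.sum_div, Finset.sum_add_distrib,
    ← Finset.mul_sum, sum_qBern hq0, sum_qInt_mul_qBern hq0]
  field_simp
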